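/- arXiv:2002.08517 — 3 statements merged into one kernel-verified Lean document; each statement's English description precedes it below -/
import Mathlib

section
/- Let ρ ∈ (-1,1) and a, b ∈ ℝ. Then E[Z1²·Z2²·φ(a·Z1)·φ(b·Z2)] = ((1−ρ²)^{5/2}/(2π)) · ( (1 + a²·(1−ρ²))·(1 + b²·(1−ρ²)) − ρ² )^{−5/2} · ( (1 + a²·(1−ρ²))·(1 + b²·(1−ρ²)) + 2ρ² ). -/
open Real MeasureTheory

/-- Standard Gaussian probability density function φ. -/
noncomputable def gpdf (x : ℝ) : ℝ := (Real.sqrt (2 * Real.pi))⁻¹ * Real.exp (-(x ^ 2) / 2)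

theorem integrable_pow_mul_exp_neg_mul_sq {c : ℝ} (hc : 0 < c) (n : ℕ) :
    Integrable fun x : ℝ => x ^ n * exp (-c * x ^ 2) := by
  have := integrable_rpow_mul_exp_neg_mul_sq hc (s := n) (by linarith [n.cast_nonneg (α := ℝ)])
  simpa only [rpow_natCast] using this

theorem integral_even_pow_mul_exp_neg_mul_sq {c : ℝ} (hc : 0 < c) (k : ℕ) :
    ∫ x : ℝ, x ^ (2 * k) * exp (-c * x ^ 2) = Gamma (k + 1 / 2) / (c ^ k * √c) := by
  have h := integral_comp_abs (f := fun x : ℝ => x ^ (2 * k) * exp (-c * x ^ 2))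
  simp only [sq_abs, pow_mul] at h ⊢
  rw [h]
  have h' := integral_rpow_mul_exp_neg_mul_rpow (p := 2) (q := (2 * k : ℕ)) two_pos
    (by linarith [(2 * k).cast_nonneg (α := ℝ)]) hc
  simp only [rpow_natCast, rpow_two, pow_mul] at h'
  rw [h', show (((2 * k : ℕ) : ℝ) + 1) / 2 = k + 1 / 2 by push_cast; ring,
    show -(((2 * k : ℕ) : ℝ) + 1) / 2 = -(k + 1 / 2) by push_cast; ring, rpow_neg hc.le,
    rpow_add hc, rpow_natCast, ← sqrt_eq_rpow]
  field_simp

theorem integral_sq_mul_exp_neg_mul_sq_div_two {c : ℝ} (hc : 0 < c) :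
    ∫ x : ℝ, x ^ 2 * exp (-(c / 2) * x ^ 2) = √(2 * π) / √c / c := by
  have h := integral_even_pow_mul_exp_neg_mul_sq (half_pos hc) 1
  rw [show ((1 : ℕ) : ℝ) + 1 / 2 = 1 / 2 + 1 by norm_num, Gamma_add_one (by norm_num),
    Gamma_one_half_eq] at h
  norm_num only at h
  rw [h, sqrt_div hc.le, sqrt_mul zero_le_two]
  field_simp

theorem integral_pow_four_mul_exp_neg_mul_sq_div_two {c : ℝ} (hc : 0 < c) :
    ∫ x : ℝ, x ^ 4 * exp (-(c / 2) * x ^ 2) = 3 * (√(2 * π) / √c / c ^ 2) := by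
  have h := integral_even_pow_mul_exp_neg_mul_sq (half_pos hc) 2
  rw [show ((2 : ℕ) : ℝ) + 1 / 2 = 1 / 2 + 1 + 1 by norm_num, Gamma_add_one (by norm_num),
    Gamma_add_one (by norm_num), Gamma_one_half_eq] at h
  norm_num only at h
  rw [h, sqrt_div hc.le, sqrt_mul zero_le_two]
  field_simp

theorem integral_exp_neg_mul_sq_div_two {c : ℝ} (hc : 0 < c) :
    ∫ x : ℝ, exp (-(c / 2) * x ^ 2) = √(2 * π) / √c := by
  rw [integral_gaussian, ← sqrt_div (by positivity)]
  congr 1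
  field_simp

theorem integral_affine_sq_mul_exp_neg_mul_sq_div_two {c : ℝ} (hc : 0 < c) (u v : ℝ) :
    ∫ y : ℝ, (u + v * y) ^ 2 * exp (-(c / 2) * y ^ 2) =
      √(2 * π) / √c * (u ^ 2 + v ^ 2 / c) := by
  have i (n : ℕ) := integrable_pow_mul_exp_neg_mul_sq (half_pos hc) n
  have e : (fun y : ℝ => (u + v * y) ^ 2 * exp (-(c / 2) * y ^ 2)) = fun y =>
      u ^ 2 * (y ^ 0 * exp (-(c / 2) * y ^ 2)) + 2 * u * v * (y ^ 1 * exp (-(c / 2) * y ^ 2)) +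
        v ^ 2 * (y ^ 2 * exp (-(c / 2) * y ^ 2)) := by
    ext y; ring
  have odd : ∫ y : ℝ, y ^ 1 * exp (-(c / 2) * y ^ 2) = 0 := by
    have h := integral_neg_eq_self (fun y : ℝ => y ^ 1 * exp (-(c / 2) * y ^ 2)) volume
    simp only [pow_one, neg_mul, neg_sq, integral_neg] at h ⊢
    linarith
  rw [e, integral_add (by exact ((i 0).const_mul _).add ((i 1).const_mul _)) ((i 2).const_mul _),
    integral_add ((i 0).const_mul _) ((i 1).const_mul _)]
  simp only [integral_const_mul, odd, integral_sq_mul_exp_neg_mul_sq_div_two hc, pow_zero, one_mul,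
    integral_exp_neg_mul_sq_div_two hc]
  ring

/-- The inner Gaussian integral, by completing the square in `y`. -/
theorem integral_sq_mul_gpdf_affine (x r s a b : ℝ) :
    ∫ y : ℝ, (x ^ 2 * (r * x + s * y) ^ 2 * gpdf (a * x) * gpdf (b * (r * x + s * y))) *
        gpdf x * gpdf y =
      (√(2 * π))⁻¹ ^ 3 / √(1 + b ^ 2 * s ^ 2) *
        ((r / (1 + b ^ 2 * s ^ 2)) ^ 2 *
            (x ^ 4 * exp (-((1 + a ^ 2 + b ^ 2 * r ^ 2 / (1 + b ^ 2 * s ^ 2)) / 2) * x ^ 2)) +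
          s ^ 2 / (1 + b ^ 2 * s ^ 2) *
            (x ^ 2 * exp (-((1 + a ^ 2 + b ^ 2 * r ^ 2 / (1 + b ^ 2 * s ^ 2)) / 2) * x ^ 2))) := by
  set B := 1 + b ^ 2 * s ^ 2 with hB
  have hB0 : 0 < B := by positivity
  rw [← integral_sub_right_eq_self _ (b ^ 2 * r * s * x / B)]
  have e (y : ℝ) : (x ^ 2 * (r * x + s * (y - b ^ 2 * r * s * x / B)) ^ 2 * gpdf (a * x) *
        gpdf (b * (r * x + s * (y - b ^ 2 * r * s * x / B)))) * gpdf x *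
        gpdf (y - b ^ 2 * r * s * x / B) =
      (√(2 * π))⁻¹ ^ 4 * x ^ 2 * exp (-((1 + a ^ 2 + b ^ 2 * r ^ 2 / B) / 2) * x ^ 2) *
        ((r * x / B + s * y) ^ 2 * exp (-(B / 2) * y ^ 2)) := by
    have h1 : r * x + s * (y - b ^ 2 * r * s * x / B) = r * x / B + s * y := by
      field_simp
      rw [hB]; ring
    have h2 : exp (-((a * x) ^ 2) / 2) * exp (-((b * (r * x / B + s * y)) ^ 2) / 2) *
        exp (-(x ^ 2) / 2) * exp (-((y - b ^ 2 * r * s * x / B) ^ 2) / 2) =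
        exp (-((1 + a ^ 2 + b ^ 2 * r ^ 2 / B) / 2) * x ^ 2) * exp (-(B / 2) * y ^ 2) := by
      simp only [← exp_add]
      congr 1
      field_simp
      rw [hB]; ring
    rw [h1]
    simp only [gpdf]
    linear_combination (√(2 * π))⁻¹ ^ 4 * x ^ 2 * (r * x / B + s * y) ^ 2 * h2
  simp only [e]
  rw [integral_const_mul, integral_affine_sq_mul_exp_neg_mul_sq_div_two hB0]
  field_simp

/-- For a centered bivariate Gaussian pair `(Z₁, Z₂)` with unit variances and correlation
`ρ ∈ (-1,1)` (realised as `Z₁ = x`, `Z₂ = ρ·x + √(1−ρ²)·y` for independent standard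
Gaussians `x, y`) and `a, b : ℝ`,
`E[Z₁²·Z₂²·φ(a·Z₁)·φ(b·Z₂)]` has the stated closed form. -/
theorem sq_sq_pdf_pdf_expectation (ρ a b : ℝ) (hρ : ρ ∈ Set.Ioo (-1 : ℝ) 1) :
    (∫ x : ℝ, ∫ y : ℝ,
        (x ^ 2 * (ρ * x + Real.sqrt (1 - ρ ^ 2) * y) ^ 2 *
          gpdf (a * x) * gpdf (b * (ρ * x + Real.sqrt (1 - ρ ^ 2) * y))) *
          gpdf x * gpdf y)
    = ((1 - ρ ^ 2) ^ ((5 : ℝ) / 2) / (2 * Real.pi)) *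
        ((1 + a ^ 2 * (1 - ρ ^ 2)) * (1 + b ^ 2 * (1 - ρ ^ 2)) - ρ ^ 2) ^ (-(5 : ℝ) / 2) *
        ((1 + a ^ 2 * (1 - ρ ^ 2)) * (1 + b ^ 2 * (1 - ρ ^ 2)) + 2 * ρ ^ 2) := by
  have hs : 0 < 1 - ρ ^ 2 := by nlinarith [hρ.1, hρ.2]
  simp only [integral_sq_mul_gpdf_affine, sq_sqrt hs.le]
  set t := 1 - ρ ^ 2 with ht
  set B := 1 + b ^ 2 * t with hB
  have hB0 : 0 < B := by positivity
  set p := 1 + a ^ 2 + b ^ 2 * ρ ^ 2 / B with hp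
  have hp0 : 0 < p := by positivity
  have i (n : ℕ) := integrable_pow_mul_exp_neg_mul_sq (half_pos hp0) n
  rw [integral_const_mul, integral_add ((i 4).const_mul _) ((i 2).const_mul _),
    integral_const_mul, integral_const_mul, integral_sq_mul_exp_neg_mul_sq_div_two hp0,
    integral_pow_four_mul_exp_neg_mul_sq_div_two hp0]
  have hD : (1 + a ^ 2 * t) * B = t * (p * B) + ρ ^ 2 := by
    rw [hp]
    field_simp
    rw [hB, ht]; ring
  have h5 {z : ℝ} (hz : 0 < z) : z ^ ((5 : ℝ) / 2) = z ^ 2 * √z := by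
    rw [show (5 : ℝ) / 2 = (2 : ℕ) + 1 / 2 by norm_num, rpow_add hz, rpow_natCast, ← sqrt_eq_rpow]
  have hD0 : 0 < t * (p * B) := by positivity
  rw [hD, add_sub_cancel_right, neg_div, rpow_neg hD0.le, h5 hD0, h5 hs, sqrt_mul hs.le,
    sqrt_mul hp0.le]
  have hπ : √(2 * π) ^ 2 = 2 * π := sq_sqrt (by positivity)
  have hq0 : √(2 * π) ≠ 0 := by positivity
  generalize √(2 * π) = q at hπ hq0 ⊢
  rw [← hπ]
  field_simp
  ring
end

section
/- Let ρ ∈ [-1,1] and a, b ∈ ℝ. Then E[Φ(a·Z1)·Φ(b·Z2)] = (1/4)·( 1 + (2/π)·arcsin( a·b·ρ / √((1+a²)·(1+b²)) ) ). -/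
open Real MeasureTheory

/-- Standard Gaussian cumulative distribution function Φ. -/
noncomputable def gcdf (x : ℝ) : ℝ := ∫ t in Set.Iic x, gpdf t

theorem gpdf_nonneg (x : ℝ) : 0 ≤ gpdf x := by unfold gpdf; positivity

theorem gpdf_neg (x : ℝ) : gpdf (-x) = gpdf x := by simp [gpdf]

theorem gpdf_zero_mul_self : gpdf 0 * gpdf 0 = (2 * π)⁻¹ := by
  have h : gpdf 0 = (√(2 * π))⁻¹ := by norm_num [gpdf]
  rw [h, ← mul_inv, Real.mul_self_sqrt (by positivity)]

theorem gpdf_mul_gpdf {x y z w : ℝ} (h : x ^ 2 + y ^ 2 = z ^ 2 + w ^ 2) :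
    gpdf x * gpdf y = gpdf z * gpdf w := by
  simp only [gpdf]
  rw [mul_mul_mul_comm, mul_mul_mul_comm _ (rexp (-z ^ 2 / 2)), ← Real.exp_add, ← Real.exp_add]
  congr 2
  linarith

theorem gpdf_le_one (x : ℝ) : gpdf x ≤ 1 := by
  unfold gpdf
  have h1 : 1 ≤ √(2 * π) := by
    rw [Real.one_le_sqrt]
    linarith [Real.pi_gt_three]
  have h2 : rexp (-(x ^ 2) / 2) ≤ 1 := Real.exp_le_one_iff.2 (by nlinarith [sq_nonneg x])
  exact mul_le_one₀ (inv_le_one_of_one_le₀ h1) (Real.exp_nonneg _) h2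

theorem gpdf_eq_gaussianPDFReal : gpdf = ProbabilityTheory.gaussianPDFReal 0 1 := by
  ext x
  simp [gpdf, ProbabilityTheory.gaussianPDFReal]

theorem integrable_gpdf : Integrable gpdf := by
  rw [gpdf_eq_gaussianPDFReal]
  exact ProbabilityTheory.integrable_gaussianPDFReal 0 1

theorem integral_gpdf : ∫ x, gpdf x = 1 := by
  rw [gpdf_eq_gaussianPDFReal]
  exact ProbabilityTheory.integral_gaussianPDFReal_eq_one 0 one_ne_zero

theorem integral_gpdf_comp_mul_add {k : ℝ} (hk : 0 < k) (d : ℝ) :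
    ∫ x, gpdf (k * x + d) = k⁻¹ := by
  have h := Measure.integral_comp_mul_left (fun x => gpdf (x + d)) k
  rw [h, integral_add_right_eq_self, integral_gpdf]
  simp [abs_of_pos hk]

theorem integrable_id_mul_gpdf : Integrable fun x => x * gpdf x := by
  have h := (integrable_mul_exp_neg_mul_sq (b := 1 / 2) (by norm_num)).const_mul (√(2 * π))⁻¹
  refine h.congr (.of_forall fun x => ?_)
  simp only [gpdf]
  ring_nf

theorem hasDerivAt_gpdf (x : ℝ) : HasDerivAt gpdf (-x * gpdf x) x := by
  have h := (((hasDerivAt_pow 2 x).neg.div_const 2).exp).const_mul (√(2 * π))⁻¹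
  refine h.congr_deriv ?_
  simp only [gpdf, Pi.neg_apply]
  push_cast
  ring

@[fun_prop]
theorem continuous_gpdf : Continuous gpdf := by
  unfold gpdf
  fun_prop

theorem hasDerivAt_gcdf (x : ℝ) : HasDerivAt gcdf (gpdf x) x := by
  have h : gcdf = fun u => gcdf 0 + ∫ t in (0 : ℝ)..u, gpdf t := by
    ext u
    rw [← intervalIntegral.integral_Iic_sub_Iic integrable_gpdf.integrableOn
      integrable_gpdf.integrableOn]
    simp only [gcdf]
    ring
  rw [h]
  exact (continuous_gpdf.integral_hasStrictDerivAt 0 x).hasDerivAt.const_add _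

@[fun_prop]
theorem continuous_gcdf : Continuous gcdf :=
  continuous_iff_continuousAt.2 fun x => (hasDerivAt_gcdf x).continuousAt

theorem gcdf_nonneg (x : ℝ) : 0 ≤ gcdf x := integral_nonneg gpdf_nonneg

theorem gcdf_le_one (x : ℝ) : gcdf x ≤ 1 := by
  rw [← integral_gpdf]
  exact setIntegral_le_integral integrable_gpdf (.of_forall gpdf_nonneg)

theorem norm_gcdf_le_one (x : ℝ) : ‖gcdf x‖ ≤ 1 := by
  rw [Real.norm_of_nonneg (gcdf_nonneg x)]
  exact gcdf_le_one x

theorem gcdf_neg (x : ℝ) : gcdf (-x) = 1 - gcdf x := by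
  have h1 : gcdf (-x) = ∫ t in Set.Ioi x, gpdf t := by
    have h := integral_comp_neg_Iic (-x) gpdf
    simpa [gpdf_neg, gcdf] using h
  have h2 := intervalIntegral.integral_Iic_add_Ioi (b := x) (f := gpdf) (μ := volume)
    integrable_gpdf.integrableOn integrable_gpdf.integrableOn
  rw [integral_gpdf, ← h1] at h2
  simp only [gcdf] at *
  linarith

theorem gcdf_zero : gcdf 0 = 1 / 2 := by
  have h := gcdf_neg 0
  rw [neg_zero] at h
  linarith

theorem integrable_gcdf_mul {f g : ℝ → ℝ} (hf : Continuous f) (hg : Integrable g) :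
    Integrable fun x => gcdf (f x) * g x :=
  hg.bdd_mul (c := 1) (by fun_prop) (.of_forall fun x => norm_gcdf_le_one _)

theorem integral_gcdf_mul_gpdf (b : ℝ) : ∫ y, gcdf (b * y) * gpdf y = 1 / 2 := by
  have h1 := integral_neg_eq_self (fun y => gcdf (b * y) * gpdf y) volume
  have h2 : ∀ y, gcdf (b * -y) * gpdf (-y) = gpdf y - gcdf (b * y) * gpdf y := fun y => by
    rw [mul_neg, gcdf_neg, gpdf_neg]
    ring
  simp only [h2] at h1
  rw [integral_sub integrable_gpdf (integrable_gcdf_mul (by fun_prop) integrable_gpdf),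
    integral_gpdf] at h1
  linarith

theorem eq_of_hasDerivAt_of_eq_zero {f g f' : ℝ → ℝ} (hf : ∀ x, HasDerivAt f (f' x) x)
    (hg : ∀ x, HasDerivAt g (f' x) x) (h : f 0 = g 0) (x : ℝ) : f x = g x := by
  have hd : ∀ x, HasDerivAt (f - g) 0 x := fun x => by simpa using (hf x).sub (hg x)
  have := is_const_of_deriv_eq_zero (fun x => (hd x).differentiableAt) (fun x => (hd x).deriv) x 0
  simp only [Pi.sub_apply] at this
  linarith

theorem integral_gpdf_add_mul_gpdf (a b : ℝ) :
    ∫ y, gpdf (a + b * y) * gpdf y = gpdf (a / √(1 + b ^ 2)) * (√(1 + b ^ 2))⁻¹ := by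
  have hpos : 0 < 1 + b ^ 2 := by positivity
  set k := √(1 + b ^ 2) with hk
  have hk0 : 0 < k := Real.sqrt_pos.2 hpos
  have hk2 : k ^ 2 = 1 + b ^ 2 := Real.sq_sqrt hpos.le
  have h : ∀ y, gpdf (a + b * y) * gpdf y = gpdf (a / k) * gpdf (k * y + a * b / k) := fun y => by
    apply gpdf_mul_gpdf
    have : (a / k) ^ 2 + (k * y + a * b / k) ^ 2
        = a ^ 2 * (1 + b ^ 2) / k ^ 2 + k ^ 2 * y ^ 2 + 2 * y * a * b := by
      field_simp
      ring
    rw [this, hk2, mul_div_cancel_right₀ _ hpos.ne']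
    ring
  simp only [h]
  rw [integral_const_mul, integral_gpdf_comp_mul_add hk0]

/-- `E[Φ(a + bY)] = Φ(a / √(1 + b²))` for a standard Gaussian `Y`. -/
theorem integral_gcdf_add_mul_gpdf (a b : ℝ) :
    ∫ y, gcdf (a + b * y) * gpdf y = gcdf (a / √(1 + b ^ 2)) := by
  refine eq_of_hasDerivAt_of_eq_zero (f := fun a => ∫ y, gcdf (a + b * y) * gpdf y)
    (g := fun a => gcdf (a / √(1 + b ^ 2)))
    (f' := fun a => ∫ y, gpdf (a + b * y) * gpdf y) (fun a => ?_) (fun a => ?_) ?_ a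
  · refine (hasDerivAt_integral_of_dominated_loc_of_deriv_le (bound := gpdf)
      (F := fun a y => gcdf (a + b * y) * gpdf y) (F' := fun a y => gpdf (a + b * y) * gpdf y)
      Filter.univ_mem (.of_forall fun a => ?_)
      (integrable_gcdf_mul (by fun_prop) integrable_gpdf) ?_ ?_ integrable_gpdf ?_).2
    · exact Continuous.aestronglyMeasurable (by fun_prop)
    · exact Continuous.aestronglyMeasurable (by fun_prop)
    · refine .of_forall fun y a _ => ?_
      rw [Real.norm_of_nonneg (mul_nonneg (gpdf_nonneg _) (gpdf_nonneg _))]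
      exact mul_le_of_le_one_left (gpdf_nonneg _) (gpdf_le_one _)
    · refine .of_forall fun y a _ => ?_
      exact ((hasDerivAt_gcdf _).comp_add_const a (b * y)).mul_const _
  · simp only [integral_gpdf_add_mul_gpdf]
    have h := (hasDerivAt_gcdf (a / √(1 + b ^ 2))).comp a
      ((hasDerivAt_id a).div_const (√(1 + b ^ 2)))
    simpa [Function.comp_def] using h
  · simp [integral_gcdf_mul_gpdf, gcdf_zero]

theorem gpdf_mul_mul_gpdf_mul (a b x : ℝ) :
    gpdf (a * x) * gpdf (b * x) = gpdf 0 * gpdf (√(a ^ 2 + b ^ 2) * x) := by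
  apply gpdf_mul_gpdf
  rw [mul_pow √_, Real.sq_sqrt (by positivity)]
  ring

theorem integrable_gpdf_mul {k : ℝ} (hk : k ≠ 0) : Integrable fun x => gpdf (k * x) :=
  integrable_gpdf.comp_mul_left' hk

theorem integrable_id_mul_gpdf_mul {k : ℝ} (hk : k ≠ 0) :
    Integrable fun x => x * gpdf (k * x) := by
  have h := (integrable_id_mul_gpdf.comp_mul_left' hk).const_mul k⁻¹
  refine h.congr (.of_forall fun x => ?_)
  simp only
  field_simp

theorem integral_gpdf_mul_mul_gpdf_mul (a : ℝ) {k : ℝ} (hk : 0 < k) :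
    ∫ x, gpdf (a * x) * gpdf (k * x) = gpdf 0 * (√(a ^ 2 + k ^ 2))⁻¹ := by
  simp only [gpdf_mul_mul_gpdf_mul, integral_const_mul]
  have := integral_gpdf_comp_mul_add (k := √(a ^ 2 + k ^ 2)) (Real.sqrt_pos.2 (by positivity)) 0
  simp only [add_zero] at this
  rw [this]

theorem integral_gcdf_mul_id_mul_gpdf (a : ℝ) {k : ℝ} (hk : 0 < k) :
    ∫ x, gcdf (a * x) * (x * gpdf (k * x)) = a / k ^ 2 * (gpdf 0 * (√(a ^ 2 + k ^ 2))⁻¹) := by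
  have hi0 : Integrable fun x => gcdf (a * x) * gpdf (k * x) :=
    integrable_gcdf_mul (by fun_prop) (integrable_gpdf_mul hk.ne')
  have hi1 : Integrable fun x => gcdf (a * x) * (x * gpdf (k * x)) :=
    integrable_gcdf_mul (by fun_prop) (integrable_id_mul_gpdf_mul hk.ne')
  have hi2 : Integrable fun x => gpdf (a * x) * gpdf (k * x) := by
    simp only [gpdf_mul_mul_gpdf_mul]
    exact (integrable_gpdf_mul (Real.sqrt_pos.2 (by positivity)).ne').const_mul _
  have hd : ∀ x, HasDerivAt (fun x => gcdf (a * x) * gpdf (k * x))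
      (a * (gpdf (a * x) * gpdf (k * x)) - k ^ 2 * (gcdf (a * x) * (x * gpdf (k * x)))) x := by
    intro x
    have h1 := (hasDerivAt_gcdf (a * x)).comp x ((hasDerivAt_id x).const_mul a)
    have h2 := (hasDerivAt_gpdf (k * x)).comp x ((hasDerivAt_id x).const_mul k)
    refine (h1.mul h2).congr_deriv ?_
    simp
    ring
  have h := integral_eq_zero_of_hasDerivAt_of_integrable hd
    ((hi2.const_mul a).sub (hi1.const_mul (k ^ 2))) hi0
  rw [integral_sub (hi2.const_mul a) (hi1.const_mul (k ^ 2)), integral_const_mul,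
    integral_const_mul, integral_gpdf_mul_mul_gpdf_mul a hk] at h
  rw [div_mul_eq_mul_div, eq_div_iff (pow_pos hk 2).ne']
  linarith

theorem integral_gcdf_mul_id_mul_gpdf_mul_gpdf (a b : ℝ) :
    ∫ x, gcdf (a * x) * (x * gpdf (b * x)) * gpdf x
      = a / (2 * π * (1 + b ^ 2) * √(1 + a ^ 2 + b ^ 2)) := by
  have h : ∀ x, gcdf (a * x) * (x * gpdf (b * x)) * gpdf x
      = gpdf 0 * (gcdf (a * x) * (x * gpdf (√(b ^ 2 + 1 ^ 2) * x))) := fun x => by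
    have := gpdf_mul_mul_gpdf_mul b 1 x
    rw [one_mul] at this
    linear_combination (gcdf (a * x) * x) * this
  simp only [h, integral_const_mul]
  rw [integral_gcdf_mul_id_mul_gpdf a (Real.sqrt_pos.2 (by positivity)),
    Real.sq_sqrt (by positivity)]
  have h2 : a ^ 2 + (b ^ 2 + 1 ^ 2) = 1 + a ^ 2 + b ^ 2 := by ring
  rw [h2]
  calc _ = (gpdf 0 * gpdf 0) * (a / (b ^ 2 + 1 ^ 2) * (√(1 + a ^ 2 + b ^ 2))⁻¹) := by ring
    _ = _ := by
      rw [gpdf_zero_mul_self]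
      have : 0 < √(1 + a ^ 2 + b ^ 2) := Real.sqrt_pos.2 (by positivity)
      field_simp
      ring

theorem hasDerivAt_arctan_div_sqrt (a b : ℝ) :
    HasDerivAt (fun b => arctan (a * b / √(1 + a ^ 2 + b ^ 2)))
      (a / ((1 + b ^ 2) * √(1 + a ^ 2 + b ^ 2))) b := by
  have hpos : 0 < 1 + a ^ 2 + b ^ 2 := by positivity
  have hS := Real.sqrt_pos.2 hpos
  have hS2 := Real.sq_sqrt hpos.le
  have h1 := ((hasDerivAt_pow 2 b).const_add (1 + a ^ 2)).sqrt hpos.ne'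
  have h := (((hasDerivAt_id b).const_mul a).div h1 hS.ne').arctan
  refine h.congr_deriv ?_
  simp only [id, Pi.div_apply]
  generalize √(1 + a ^ 2 + b ^ 2) = S at *
  have e1 : 1 + (a * b / S) ^ 2 = (1 + a ^ 2) * (1 + b ^ 2) / S ^ 2 := by
    field_simp
    rw [hS2]
    ring
  rw [e1]
  have : 0 < 1 + a ^ 2 := by positivity
  have : 0 < 1 + b ^ 2 := by positivity
  push_cast
  field_simp
  rw [hS2]
  ring

theorem arctan_div_sqrt_eq_arcsin (a b : ℝ) :
    arctan (a * b / √(1 + a ^ 2 + b ^ 2)) = arcsin (a * b / √((1 + a ^ 2) * (1 + b ^ 2))) := by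
  have hpos : 0 < 1 + a ^ 2 + b ^ 2 := by positivity
  have hS := Real.sqrt_pos.2 hpos
  have hS2 := Real.sq_sqrt hpos.le
  have e : (1 + a ^ 2) * (1 + b ^ 2)
      = (1 + (a * b / √(1 + a ^ 2 + b ^ 2)) ^ 2) * √(1 + a ^ 2 + b ^ 2) ^ 2 := by
    field_simp
    rw [hS2]
    ring
  rw [arctan_eq_arcsin, e, Real.sqrt_mul (by positivity), Real.sqrt_sq hS.le, div_div,
    mul_comm √(1 + a ^ 2 + b ^ 2)]

/-- `E[Φ(aX)Φ(bX)]` for a standard Gaussian `X`. -/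
theorem integral_gcdf_mul_gcdf_mul_gpdf (a b : ℝ) :
    ∫ x, gcdf (a * x) * gcdf (b * x) * gpdf x
      = 1 / 4 * (1 + 2 / π * arcsin (a * b / √((1 + a ^ 2) * (1 + b ^ 2)))) := by
  rw [← arctan_div_sqrt_eq_arcsin]
  refine eq_of_hasDerivAt_of_eq_zero
    (f := fun b => ∫ x, gcdf (a * x) * gcdf (b * x) * gpdf x)
    (g := fun b => 1 / 4 * (1 + 2 / π * arctan (a * b / √(1 + a ^ 2 + b ^ 2))))
    (f' := fun b => ∫ x, gcdf (a * x) * (x * gpdf (b * x)) * gpdf x)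
    (fun b => ?_) (fun b => ?_) ?_ b
  · refine (hasDerivAt_integral_of_dominated_loc_of_deriv_le (bound := fun x => ‖x * gpdf x‖)
      (F := fun b x => gcdf (a * x) * gcdf (b * x) * gpdf x)
      (F' := fun b x => gcdf (a * x) * (x * gpdf (b * x)) * gpdf x)
      Filter.univ_mem (.of_forall fun b => ?_) ?_ ?_ ?_ integrable_id_mul_gpdf.norm ?_).2
    · exact Continuous.aestronglyMeasurable (by fun_prop)
    · simp only [mul_assoc (gcdf _)]
      exact integrable_gcdf_mul (by fun_prop) (integrable_gcdf_mul (by fun_prop) integrable_gpdf)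
    · exact Continuous.aestronglyMeasurable (by fun_prop)
    · refine .of_forall fun x b _ => ?_
      have e : gcdf (a * x) * (x * gpdf (b * x)) * gpdf x
          = gcdf (a * x) * gpdf (b * x) * (x * gpdf x) := by ring
      rw [e, norm_mul, norm_mul]
      refine mul_le_of_le_one_left (norm_nonneg _) (mul_le_one₀ (norm_gcdf_le_one _)
        (norm_nonneg _) ?_)
      rw [Real.norm_of_nonneg (gpdf_nonneg _)]
      exact gpdf_le_one _
    · refine .of_forall fun x b _ => ?_
      have h := (hasDerivAt_gcdf (b * x)).comp b ((hasDerivAt_id b).mul_const x)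
      refine ((h.const_mul (gcdf (a * x))).mul_const (gpdf x)).congr_deriv ?_
      ring
  · refine ((((hasDerivAt_arctan_div_sqrt a b).const_mul (2 / π)).const_add 1).const_mul
      (1 / 4)).congr_deriv ?_
    rw [integral_gcdf_mul_id_mul_gpdf_mul_gpdf]
    have : 0 < √(1 + a ^ 2 + b ^ 2) := Real.sqrt_pos.2 (by positivity)
    field_simp
    norm_num
  · have h := integral_gcdf_mul_gpdf a
    simp only [zero_mul, gcdf_zero, mul_right_comm _ (1 / 2 : ℝ), integral_mul_const, h]
    norm_num

/-- For a centered bivariate Gaussian pair `(Z₁, Z₂)` with unit variances and correlation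
`ρ ∈ [-1,1]` (realised as `Z₁ = x`, `Z₂ = ρ·x + √(1−ρ²)·y` for independent standard
Gaussians `x, y`) and `a, b : ℝ`,
`E[Φ(a·Z₁)·Φ(b·Z₂)] = (1/4)·(1 + (2/π)·arcsin(a·b·ρ/√((1+a²)·(1+b²))))`. -/
theorem cdf_cdf_expectation (ρ a b : ℝ) (hρ : ρ ∈ Set.Icc (-1 : ℝ) 1) :
    (∫ x : ℝ, ∫ y : ℝ,
        gcdf (a * x) * gcdf (b * (ρ * x + Real.sqrt (1 - ρ ^ 2) * y)) * gpdf x * gpdf y)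
    = (1 / 4) * (1 + (2 / Real.pi) *
        Real.arcsin (a * b * ρ / Real.sqrt ((1 + a ^ 2) * (1 + b ^ 2)))) := by
  obtain ⟨h1, h2⟩ := hρ
  set s := √(1 - ρ ^ 2)
  have hs : s ^ 2 = 1 - ρ ^ 2 := Real.sq_sqrt (by nlinarith)
  have hpos : 0 < 1 + (b * s) ^ 2 := by positivity
  have hc2 : √(1 + (b * s) ^ 2) ^ 2 = 1 + (b * s) ^ 2 := Real.sq_sqrt hpos.le
  have hc : 0 < √(1 + (b * s) ^ 2) := Real.sqrt_pos.2 hpos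
  have inner : ∀ x, ∫ y, gcdf (a * x) * gcdf (b * (ρ * x + s * y)) * gpdf x * gpdf y
      = gcdf (a * x) * gcdf (b * ρ / √(1 + (b * s) ^ 2) * x) * gpdf x := fun x => by
    have e : ∀ y, gcdf (a * x) * gcdf (b * (ρ * x + s * y)) * gpdf x * gpdf y
        = gcdf (a * x) * gpdf x * (gcdf (b * ρ * x + b * s * y) * gpdf y) := fun y => by
      rw [show b * (ρ * x + s * y) = b * ρ * x + b * s * y by ring]
      ring
    simp only [e, integral_const_mul]
    rw [integral_gcdf_add_mul_gpdf, mul_div_right_comm]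
    ring
  simp only [inner]
  rw [integral_gcdf_mul_gcdf_mul_gpdf]
  generalize √(1 + (b * s) ^ 2) = c at *
  have e : (1 + a ^ 2) * (1 + b ^ 2) = (1 + a ^ 2) * (1 + (b * ρ / c) ^ 2) * c ^ 2 := by
    have : (1 + (b * ρ / c) ^ 2) * c ^ 2 = c ^ 2 + b ^ 2 * ρ ^ 2 := by
      field_simp
    rw [mul_assoc, this, hc2, mul_pow, hs]
    ring
  rw [e, Real.sqrt_mul (x := (1 + a ^ 2) * (1 + (b * ρ / c) ^ 2)) (by positivity) (c ^ 2),
    Real.sqrt_sq hc.le]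
  congr 4
  field_simp
end

section
/- Let ψ : ℝ → ℝ be measurable with |ψ(x)| ≤ c·(1+|x|)^n for some c > 0, n ∈ ℕ and all x ∈ ℝ. Then the function (s1, s2, ρ) ↦ E[ ψ(s1·G1) · ψ( s2·(ρ·G1 + √(1−ρ²)·G2) ) ], where G1, G2 are independent standard Gaussians, is infinitely differentiable (C^∞) on (0,∞) × (0,∞) × (-1,1). -/
open Real MeasureTheory Set

universe u

theorem le_two_div_mul_exp {ε : ℝ} (hε : 0 < ε) (x : ℝ) : x ≤ 2 / ε * exp (ε / 2 * x) := by
  have := add_one_le_exp (ε / 2 * x)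
  rw [div_mul_eq_mul_div, le_div_iff₀ hε]
  linarith

theorem integrable_laplace_of_mem_ball {Z : Type*} [MeasurableSpace Z] {μ : Measure Z}
    {W E : Type*} [NormedAddCommGroup W] [NormedSpace ℝ W] [NormedAddCommGroup E]
    {L : Z → W →L[ℝ] ℝ} (hL : AEStronglyMeasurable L μ)
    {f : Z → E} (hf : AEStronglyMeasurable f μ) {w : W} {ε : ℝ}
    (hint : Integrable (fun z => ‖f z‖ * exp (L z w + ε * ‖L z‖)) μ)
    {v : W} (hv : v ∈ Metric.ball w (ε / 2)) :
    Integrable (fun z => ‖f z‖ * exp (L z v + ε / 2 * ‖L z‖)) μ := by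
  refine hint.mono' (hf.norm.mul (continuous_exp.comp_aestronglyMeasurable
    ((hL.apply_continuousLinearMap v).add (hL.norm.const_mul (ε / 2))))) (.of_forall fun z => ?_)
  rw [norm_of_nonneg (by positivity)]
  gcongr ‖f z‖ * exp ?_
  have h1 := (le_abs_self _).trans ((L z).le_opNorm (v - w))
  rw [map_sub] at h1
  nlinarith [mul_le_mul_of_nonneg_left (mem_ball_iff_norm.1 hv).le (norm_nonneg (L z))]

/-- Differentiation under the integral sign for the Laplace transform `w ↦ ∫ exp (L z w) • f z`. -/
theorem hasFDerivAt_laplace {Z : Type*} [MeasurableSpace Z] {μ : Measure Z}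
    {W E : Type*} [NormedAddCommGroup W] [NormedSpace ℝ W]
    [NormedAddCommGroup E] [NormedSpace ℝ E]
    {L : Z → W →L[ℝ] ℝ} (hL : AEStronglyMeasurable L μ)
    {f : Z → E} (hf : AEStronglyMeasurable f μ) {w : W} {ε : ℝ} (hε : 0 < ε)
    (hint : Integrable (fun z => ‖f z‖ * exp (L z w + ε * ‖L z‖)) μ) :
    HasFDerivAt (fun w => ∫ z, exp (L z w) • f z ∂μ)
      (∫ z, exp (L z w) • (L z).smulRight (f z) ∂μ) w := by
  have hexp (v : W) : AEStronglyMeasurable (fun z => exp (L z v)) μ :=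
    continuous_exp.comp_aestronglyMeasurable (hL.apply_continuousLinearMap v)
  have hLf : AEStronglyMeasurable (fun z => (L z).smulRight (f z)) μ :=
    (ContinuousLinearMap.smulRightL ℝ W E).aestronglyMeasurable_comp₂ hL hf
  refine hasFDerivAt_integral_of_dominated_of_fderiv_le
    (F' := fun v z => exp (L z v) • (L z).smulRight (f z))
    (bound := fun z => (2 / ε) * (‖f z‖ * exp (L z w + ε * ‖L z‖)))
    (Metric.ball_mem_nhds w (half_pos hε)) (.of_forall fun v => (hexp v).smul hf) ?_
    ((hexp w).smul hLf) (.of_forall fun z v hv => ?_) (hint.const_mul _)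
    (.of_forall fun z v _ => ?_)
  · refine hint.mono' ((hexp w).smul hf) (.of_forall fun z => ?_)
    rw [norm_smul, norm_of_nonneg (exp_pos _).le, mul_comm]
    gcongr
    have := norm_nonneg (L z)
    nlinarith
  · have h1 : L z v ≤ L z w + ε / 2 * ‖L z‖ := by
      have := (le_abs_self _).trans ((L z).le_opNorm (v - w))
      rw [map_sub] at this
      nlinarith [mul_le_mul_of_nonneg_left (mem_ball_iff_norm.1 hv).le (norm_nonneg (L z))]
    have h2 : ‖L z‖ ≤ 2 / ε * exp (ε / 2 * ‖L z‖) := le_two_div_mul_exp hε _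
    rw [norm_smul, ContinuousLinearMap.norm_smulRight_apply, norm_of_nonneg (exp_pos _).le]
    calc exp (L z v) * (‖L z‖ * ‖f z‖)
        ≤ exp (L z w + ε / 2 * ‖L z‖) * (2 / ε * exp (ε / 2 * ‖L z‖) * ‖f z‖) := by gcongr
      _ = 2 / ε * (‖f z‖ * (exp (L z w + ε / 2 * ‖L z‖) * exp (ε / 2 * ‖L z‖))) := by ring
      _ = _ := by rw [← exp_add]; ring_nf
  · have h := ((L z).hasFDerivAt (x := v)).exp.smul_const (f z)
    convert h using 1
    ext x
    simp [mul_smul]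

/-- The Laplace transform `w ↦ ∫ exp (L z w) • f z` is smooth at every point around which it
converges absolutely, uniformly in the sense of `hint`. -/
theorem contDiffAt_laplace {Z : Type*} [MeasurableSpace Z] {μ : Measure Z}
    {W : Type u} [NormedAddCommGroup W] [NormedSpace ℝ W] {L : Z → W →L[ℝ] ℝ}
    (hL : AEStronglyMeasurable L μ) (n : ℕ) {E : Type u} [NormedAddCommGroup E] [NormedSpace ℝ E]
    {f : Z → E} (hf : AEStronglyMeasurable f μ) {w : W} {ε : ℝ} (hε : 0 < ε)
    (hint : Integrable (fun z => ‖f z‖ * exp (L z w + ε * ‖L z‖)) μ) :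
    ContDiffAt ℝ n (fun w => ∫ z, exp (L z w) • f z ∂μ) w := by
  have hexp (v : W) (δ : ℝ) : AEStronglyMeasurable (fun z => exp (L z v + δ * ‖L z‖)) μ :=
    continuous_exp.comp_aestronglyMeasurable
      ((hL.apply_continuousLinearMap v).add (hL.norm.const_mul δ))
  induction n generalizing E ε with
  | zero =>
    exact contDiffAt_zero.2 ⟨_, Metric.ball_mem_nhds w (half_pos hε), fun v hv =>
      (hasFDerivAt_laplace hL hf (half_pos hε)
        (integrable_laplace_of_mem_ball hL hf hint hv)).continuousAt.continuousWithinAt⟩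
  | succ n ih =>
    rw [Nat.cast_add, Nat.cast_one, contDiffAt_succ_iff_hasFDerivAt]
    refine ⟨_, ⟨_, Metric.ball_mem_nhds w (half_pos hε), fun v hv =>
      hasFDerivAt_laplace hL hf (half_pos hε) (integrable_laplace_of_mem_ball hL hf hint hv)⟩, ?_⟩
    have hLf : AEStronglyMeasurable (fun z => (L z).smulRight (f z)) μ :=
      (ContinuousLinearMap.smulRightL ℝ W E).aestronglyMeasurable_comp₂ hL hf
    refine ih hLf (half_pos hε) ((hint.const_mul (2 / ε)).mono' (hLf.norm.mul (hexp w _))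
      (.of_forall fun z => ?_))
    rw [norm_of_nonneg (by positivity), ContinuousLinearMap.norm_smulRight_apply]
    calc ‖L z‖ * ‖f z‖ * exp (L z w + ε / 2 * ‖L z‖)
        ≤ 2 / ε * exp (ε / 2 * ‖L z‖) * ‖f z‖ * exp (L z w + ε / 2 * ‖L z‖) := by
          gcongr
          exact le_two_div_mul_exp hε _
      _ = 2 / ε * (‖f z‖ * (exp (L z w + ε / 2 * ‖L z‖) * exp (ε / 2 * ‖L z‖))) := by ring
      _ = _ := by rw [← exp_add]; ring_nf

theorem integrable_one_add_abs_pow_mul_exp_neg_mul_sq {b : ℝ} (hb : 0 < b) (n : ℕ) :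
    Integrable (fun x : ℝ => (1 + |x|) ^ n * exp (-b * x ^ 2)) := by
  refine ((integrable_exp_neg_mul_sq (half_pos hb)).const_mul
    (n.factorial * exp (1 + 1 / (2 * b)))).mono' (by fun_prop) (.of_forall fun x => ?_)
  have h1 : (1 + |x|) ^ n ≤ n.factorial * exp (1 + |x|) := by
    have := pow_div_factorial_le_exp (1 + |x|) (by positivity) n
    rwa [div_le_iff₀' (by positivity)] at this
  have h2 : |x| ≤ b / 2 * x ^ 2 + 1 / (2 * b) := by
    have : b / 2 * x ^ 2 + 1 / (2 * b) - |x| = b / 2 * (|x| - 1 / b) ^ 2 := by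
      rw [sub_sq, sq_abs]; field_simp; ring
    have : 0 ≤ b / 2 * (|x| - 1 / b) ^ 2 := by positivity
    linarith
  rw [norm_of_nonneg (by positivity)]
  calc (1 + |x|) ^ n * exp (-b * x ^ 2)
      ≤ n.factorial * exp (1 + |x|) * exp (-b * x ^ 2) := by gcongr
    _ = n.factorial * exp (1 + |x| - b * x ^ 2) := by rw [mul_assoc, ← exp_add]; ring_nf
    _ ≤ n.factorial * exp (1 + 1 / (2 * b) + -(b / 2) * x ^ 2) := by gcongr; linarith
    _ = _ := by rw [exp_add, mul_assoc]

theorem integral_comp_add_mul {F : Type*} [NormedAddCommGroup F] [NormedSpace ℝ F]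
    (g : ℝ → F) (k : ℝ) {m : ℝ} (hm : 0 < m) : ∫ y, g y = m • ∫ y, g (k + m * y) := by
  rw [Measure.integral_comp_mul_left (fun y => g (k + y)), integral_add_left_eq_self g k,
    abs_of_pos (inv_pos.2 hm), smul_inv_smul₀ hm.ne']

/-- The linear functional `(α, β, γ) ↦ α u² + β u v + γ v²`. -/
noncomputable def quadEval (z : ℝ × ℝ) : ℝ × ℝ × ℝ →L[ℝ] ℝ :=
  (ContinuousLinearMap.mul ℝ ℝ (z.1 ^ 2)).coprod
    ((ContinuousLinearMap.mul ℝ ℝ (z.1 * z.2)).coprod (ContinuousLinearMap.mul ℝ ℝ (z.2 ^ 2)))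

theorem quadEval_apply (z : ℝ × ℝ) (w : ℝ × ℝ × ℝ) :
    quadEval z w = z.1 ^ 2 * w.1 + (z.1 * z.2 * w.2.1 + z.2 ^ 2 * w.2.2) := rfl

@[fun_prop]
theorem continuous_quadEval : Continuous quadEval := by
  refine continuous_clm_apply.2 fun w => ?_
  simp only [quadEval_apply]
  fun_prop

theorem norm_quadEval_le (z : ℝ × ℝ) : ‖quadEval z‖ ≤ 2 * (z.1 ^ 2 + z.2 ^ 2) := by
  refine ContinuousLinearMap.opNorm_le_bound _ (by positivity) fun w => ?_
  have h1 : |w.1| ≤ ‖w‖ := norm_fst_le w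
  have h2 : |w.2.1| ≤ ‖w‖ := (norm_fst_le w.2).trans (norm_snd_le w)
  have h3 : |w.2.2| ≤ ‖w‖ := (norm_snd_le w.2).trans (norm_snd_le w)
  rw [quadEval_apply, norm_eq_abs]
  calc |z.1 ^ 2 * w.1 + (z.1 * z.2 * w.2.1 + z.2 ^ 2 * w.2.2)|
      ≤ |z.1 ^ 2 * w.1| + (|z.1 * z.2 * w.2.1| + |z.2 ^ 2 * w.2.2|) :=
        (abs_add_le _ _).trans (by gcongr; exact abs_add_le _ _)
    _ = |z.1| ^ 2 * |w.1| + (|z.1| * |z.2| * |w.2.1| + |z.2| ^ 2 * |w.2.2|) := by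
        simp only [abs_mul, abs_pow]
    _ ≤ |z.1| ^ 2 * ‖w‖ + (|z.1| * |z.2| * ‖w‖ + |z.2| ^ 2 * ‖w‖) := by gcongr
    _ = (|z.1| ^ 2 + |z.1| * |z.2| + |z.2| ^ 2) * ‖w‖ := by ring
    _ ≤ 2 * (|z.1| ^ 2 + |z.2| ^ 2) * ‖w‖ := by
        gcongr
        nlinarith [sq_nonneg (|z.1| - |z.2|), sq_nonneg |z.1|, sq_nonneg |z.2|]
    _ = _ := by simp only [sq_abs]

/-- If `α u² + β u v + γ v² ≤ -δ (u² + v²)`, the weight `exp (α u² + β u v + γ v²)` makes products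
of functions of polynomial growth integrable, with room to spare. -/
theorem integrable_mul_exp_quadEval {ψ : ℝ → ℝ} (hmeas : Measurable ψ) {c : ℝ} {n : ℕ}
    (hb : ∀ x : ℝ, |ψ x| ≤ c * (1 + |x|) ^ n) {w : ℝ × ℝ × ℝ} {δ : ℝ} (hδ : 0 < δ)
    (hw : ∀ z, quadEval z w ≤ -δ * (z.1 ^ 2 + z.2 ^ 2)) :
    Integrable (fun z : ℝ × ℝ =>
      ‖ψ z.1 * ψ z.2‖ * exp (quadEval z w + δ / 4 * ‖quadEval z‖)) := by
  have h := (integrable_one_add_abs_pow_mul_exp_neg_mul_sq (half_pos hδ) n).const_mul c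
  refine (h.mul_prod h).mono' ?_ (.of_forall fun z => ?_)
  · have : Continuous fun z => exp (quadEval z w + δ / 4 * ‖quadEval z‖) := by fun_prop
    exact Measurable.aestronglyMeasurable (by fun_prop)
  · have h1 := hb z.1
    have h2 := hb z.2
    rw [norm_of_nonneg (by positivity), norm_mul, norm_eq_abs, norm_eq_abs]
    calc |ψ z.1| * |ψ z.2| * exp (quadEval z w + δ / 4 * ‖quadEval z‖)
        ≤ (c * (1 + |z.1|) ^ n) * (c * (1 + |z.2|) ^ n) *
          exp (-(δ / 2) * z.1 ^ 2 + -(δ / 2) * z.2 ^ 2) := by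
          refine mul_le_mul (mul_le_mul h1 h2 (abs_nonneg _) ((abs_nonneg _).trans h1))
            (exp_le_exp.2 ?_) (exp_pos _).le
            (mul_nonneg ((abs_nonneg _).trans h1) ((abs_nonneg _).trans h2))
          nlinarith [hw z, norm_quadEval_le z]
      _ = _ := by rw [exp_add]; ring

/-- The coefficients of the quadratic form in the exponent of the joint density of
`(s₁ G₁, s₂ (ρ G₁ + √(1 - ρ²) G₂))`. -/
noncomputable def gaussianCoeffs (p : ℝ × ℝ × ℝ) : ℝ × ℝ × ℝ :=
  (-(2 * (1 - p.2.2 ^ 2) * p.1 ^ 2)⁻¹, p.2.2 * ((1 - p.2.2 ^ 2) * p.1 * p.2.1)⁻¹,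
    -(2 * (1 - p.2.2 ^ 2) * p.2.1 ^ 2)⁻¹)

theorem quadEval_gaussianCoeffs (z : ℝ × ℝ) {s t r : ℝ} (hs : 0 < s) (ht : 0 < t)
    (hr : 0 < 1 - r ^ 2) :
    quadEval z (gaussianCoeffs (s, t, r)) =
      -((z.1 / s) ^ 2 - 2 * r * (z.1 / s) * (z.2 / t) + (z.2 / t) ^ 2) / (2 * (1 - r ^ 2)) := by
  rw [quadEval_apply]
  simp only [gaussianCoeffs]
  field_simp
  ring

theorem quadEval_gaussianCoeffs_le (z : ℝ × ℝ) {s t r : ℝ} (hs : 0 < s) (ht : 0 < t)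
    (hr : 0 < 1 - r ^ 2) :
    quadEval z (gaussianCoeffs (s, t, r)) ≤ -(4 * (s ^ 2 + t ^ 2))⁻¹ * (z.1 ^ 2 + z.2 ^ 2) := by
  rw [quadEval_gaussianCoeffs z hs ht hr]
  have h1 : -((z.1 / s) ^ 2 - 2 * r * (z.1 / s) * (z.2 / t) + (z.2 / t) ^ 2) / (2 * (1 - r ^ 2))
      ≤ -((z.1 / s) ^ 2 + (z.2 / t) ^ 2) / 4 := by
    rw [div_le_div_iff₀ (by positivity) (by norm_num)]
    nlinarith [sq_nonneg (z.1 / s - r * (z.2 / t)), sq_nonneg (r * (z.1 / s) - z.2 / t)]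
  have h2 : z.1 ^ 2 / (s ^ 2 + t ^ 2) ≤ (z.1 / s) ^ 2 := by
    rw [div_pow]
    gcongr
    nlinarith
  have h3 : z.2 ^ 2 / (s ^ 2 + t ^ 2) ≤ (z.2 / t) ^ 2 := by
    rw [div_pow]
    gcongr
    nlinarith
  have h4 : -(4 * (s ^ 2 + t ^ 2))⁻¹ * (z.1 ^ 2 + z.2 ^ 2) =
      -(z.1 ^ 2 / (s ^ 2 + t ^ 2) + z.2 ^ 2 / (s ^ 2 + t ^ 2)) / 4 := by
    field_simp
  linarith

theorem contDiffAt_gaussianCoeffs {s t r : ℝ} (hs : 0 < s) (ht : 0 < t) (hr : 0 < 1 - r ^ 2)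
    {m : WithTop ℕ∞} : ContDiffAt ℝ m gaussianCoeffs (s, t, r) := by
  unfold gaussianCoeffs
  fun_prop (disch := positivity)

theorem gpdf_mul_gpdf_s17 (x y : ℝ) : gpdf x * gpdf y = (2 * π)⁻¹ * exp (-(x ^ 2 + y ^ 2) / 2) := by
  have : (√(2 * π))⁻¹ * (√(2 * π))⁻¹ = (2 * π)⁻¹ := by
    rw [← mul_inv, mul_self_sqrt (by positivity)]
  rw [gpdf, gpdf, mul_mul_mul_comm, this, ← exp_add]
  ring_nf

/-- The Gaussian expectation, rewritten by the change of variables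
`u = s x`, `v = t (r x + √(1 - r²) y)`. -/
theorem integral_gaussian_eq_laplace {ψ : ℝ → ℝ} (hmeas : Measurable ψ) {c : ℝ} {n : ℕ}
    (hb : ∀ x : ℝ, |ψ x| ≤ c * (1 + |x|) ^ n) {s t r : ℝ} (hs : 0 < s) (ht : 0 < t)
    (hr : 0 < 1 - r ^ 2) :
    ∫ x : ℝ, ∫ y : ℝ, ψ (s * x) * ψ (t * (r * x + √(1 - r ^ 2) * y)) * gpdf x * gpdf y =
      (2 * π)⁻¹ * (s * (t * √(1 - r ^ 2)))⁻¹ *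
        ∫ z : ℝ × ℝ, exp (quadEval z (gaussianCoeffs (s, t, r))) • (ψ z.1 * ψ z.2) := by
  have hq : 0 < √(1 - r ^ 2) := sqrt_pos.2 hr
  have hδ : 0 < (4 * (s ^ 2 + t ^ 2))⁻¹ := by positivity
  have hint : Integrable fun z : ℝ × ℝ =>
      exp (quadEval z (gaussianCoeffs (s, t, r))) • (ψ z.1 * ψ z.2) := by
    refine (integrable_mul_exp_quadEval hmeas hb hδ
      fun z => quadEval_gaussianCoeffs_le z hs ht hr).mono' ?_ (.of_forall fun z => ?_)
    · have : Continuous fun z => exp (quadEval z (gaussianCoeffs (s, t, r))) := by fun_prop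
      exact Measurable.aestronglyMeasurable (by fun_prop)
    · rw [norm_smul, norm_of_nonneg (exp_pos _).le, mul_comm]
      gcongr
      have : 0 ≤ (4 * (s ^ 2 + t ^ 2))⁻¹ / 4 * ‖quadEval z‖ := by positivity
      linarith
  rw [Measure.volume_eq_prod] at hint ⊢
  have hinner (x : ℝ) := integral_comp_add_mul
    (fun v => exp (quadEval (s * x, v) (gaussianCoeffs (s, t, r))) • (ψ (s * x) * ψ v))
    (t * (r * x)) (mul_pos ht hq)
  have houter := integral_comp_add_mul
    (fun u => ∫ v, exp (quadEval (u, v) (gaussianCoeffs (s, t, r))) • (ψ u * ψ v)) 0 hs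
  rw [integral_prod _ hint, houter]
  simp only [zero_add, hinner]
  rw [integral_smul, smul_smul, smul_eq_mul, mul_assoc,
    inv_mul_cancel_left₀ (by positivity), ← integral_const_mul]
  refine integral_congr_ae (.of_forall fun x => ?_)
  simp only
  rw [← integral_const_mul]
  refine integral_congr_ae (.of_forall fun y => ?_)
  simp only
  have he : quadEval (s * x, t * (r * x) + t * √(1 - r ^ 2) * y) (gaussianCoeffs (s, t, r)) =
      -(x ^ 2 + y ^ 2) / 2 := by
    rw [quadEval_gaussianCoeffs _ hs ht hr]
    have h1 : (s * x) / s = x := by field_simp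
    have h2 : (t * (r * x) + t * √(1 - r ^ 2) * y) / t = r * x + √(1 - r ^ 2) * y := by
      field_simp
    simp only [h1, h2]
    rw [div_eq_div_iff (by positivity) (by norm_num)]
    linear_combination (-2) * y ^ 2 * sq_sqrt hr.le
  rw [he, mul_assoc _ (gpdf x), gpdf_mul_gpdf_s17, smul_eq_mul]
  ring_nf

/-- For a measurable activation `ψ` bounded in absolute value by a polynomial, the kernel
`(s₁, s₂, ρ) ↦ E[ψ(s₁·G₁)·ψ(s₂·(ρ·G₁ + √(1−ρ²)·G₂))]` (with `G₁, G₂` independent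
standard Gaussians) is infinitely differentiable on `(0,∞) × (0,∞) × (-1,1)`. -/
theorem kernel_smooth (ψ : ℝ → ℝ) (hmeas : Measurable ψ)
    (c : ℝ) (hc : 0 < c) (n : ℕ)
    (hb : ∀ x : ℝ, |ψ x| ≤ c * (1 + |x|) ^ n) :
    ContDiffOn ℝ (⊤ : ℕ∞)
      (fun p : ℝ × ℝ × ℝ =>
        ∫ x : ℝ, ∫ y : ℝ,
          ψ (p.1 * x) * ψ (p.2.1 * (p.2.2 * x + Real.sqrt (1 - p.2.2 ^ 2) * y)) *
            gpdf x * gpdf y)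
      (Set.Ioi (0 : ℝ) ×ˢ Set.Ioi (0 : ℝ) ×ˢ Set.Ioo (-1 : ℝ) 1) := by
  have hpos {p : ℝ × ℝ × ℝ} (hp : p ∈ Ioi (0 : ℝ) ×ˢ Ioi (0 : ℝ) ×ˢ Ioo (-1 : ℝ) 1) :
      0 < 1 - p.2.2 ^ 2 := by
    obtain ⟨-, -, h1, h2⟩ := hp
    nlinarith
  refine ContDiffOn.congr (f := fun p : ℝ × ℝ × ℝ =>
    (2 * π)⁻¹ * (p.1 * (p.2.1 * √(1 - p.2.2 ^ 2)))⁻¹ *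
      ∫ z : ℝ × ℝ, exp (quadEval z (gaussianCoeffs p)) • (ψ z.1 * ψ z.2)) ?_
    fun p hp => integral_gaussian_eq_laplace hmeas hb hp.1 hp.2.1 (hpos hp)
  rintro ⟨s, t, r⟩ hp
  have hs : 0 < s := hp.1
  have ht : 0 < t := hp.2.1
  have hr : 0 < 1 - r ^ 2 := hpos hp
  have hδ : 0 < (4 * (s ^ 2 + t ^ 2))⁻¹ := by positivity
  refine ContDiffAt.contDiffWithinAt (.mul ?_ (.comp (s, t, r)
    (g := fun w => ∫ z : ℝ × ℝ, exp (quadEval z w) • (ψ z.1 * ψ z.2))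
    (contDiffAt_infty.2 fun k => ?_)
    (contDiffAt_gaussianCoeffs hs ht hr)))
  · have hq : 0 < √(1 - r ^ 2) := sqrt_pos.2 hr
    fun_prop (disch := positivity)
  · exact contDiffAt_laplace continuous_quadEval.aestronglyMeasurable k
      (Measurable.aestronglyMeasurable (by fun_prop)) (by positivity)
      (integrable_mul_exp_quadEval hmeas hb hδ fun z => quadEval_gaussianCoeffs_le z hs ht hr)
end
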